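/- Let r ≥ 2 and ν > 2r be integers with ν even. Then the Harary graph H_{2r,ν} is (2r−2)-factor-critical. -/

import Mathlib

open SimpleGraph

/-- `G` is `n`-factor-critical if for every set `S` of exactly `n` vertices,
the graph obtained by deleting `S` has a perfect matching; formalized as:
there is a matching of `G` whose vertex set is exactly the complement of `S`. -/
def IsFactorCritical {V : Type*} (G : SimpleGraph V) (n : ℕ) : Prop :=
  ∀ S : Finset V, S.card = n →
    ∃ M : G.Subgraph, M.IsMatching ∧ M.verts = (↑S : Set V)ᶜ

/-- `G` is `k`-extendable if it is connected, has a matching with `k` edges,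
and every matching with `k` edges is contained in a perfect matching. -/
def IsExtendable {V : Type*} (G : SimpleGraph V) (k : ℕ) : Prop :=
  G.Connected ∧
  (∃ M : G.Subgraph, M.IsMatching ∧ M.edgeSet.ncard = k) ∧
  ∀ M : G.Subgraph, M.IsMatching → M.edgeSet.ncard = k →
    ∃ P : G.Subgraph, P.IsPerfectMatching ∧ M ≤ P

/-- The Harary graph `H_{2r,ν}`: the circulant graph on `ZMod ν` with
connection set `{±1, …, ±r}`. -/
def hararyEven (r ν : ℕ) : SimpleGraph (ZMod ν) :=
  SimpleGraph.fromRel (fun i j => ∃ t : ℕ, 1 ≤ t ∧ t ≤ r ∧ j = i + (t : ZMod ν))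

/-- If consecutive elements of an even-sized finite set `T` in a linear order are mapped to
adjacent vertices, then the image of `T` is the vertex set of a matching. -/
theorem exists_isMatching_verts_eq_image {V α : Type*} [LinearOrder α] (G : SimpleGraph V)
    (φ : α → V) (T : Finset α) (hT : Even T.card) (hφ : Set.InjOn φ T)
    (hadj : ∀ x ∈ T, ∀ y ∈ T, x < y → (∀ z ∈ T, x < z → y ≤ z) → G.Adj (φ x) (φ y)) :
    ∃ M : G.Subgraph, M.IsMatching ∧ M.verts = φ '' T := by
  induction hn : T.card using Nat.strong_induction_on generalizing T with
  | _ n ih =>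
  rcases T.eq_empty_or_nonempty with rfl | hne
  · exact ⟨⊥, by simp [Subgraph.IsMatching], by simp⟩
  obtain ⟨x, hx, hxmin⟩ : ∃ x ∈ T, ∀ z ∈ T, x ≤ z :=
    ⟨T.min' hne, T.min'_mem hne, fun z hz => T.min'_le z hz⟩
  have hcard := Finset.card_erase_add_one hx
  have hne' : (T.erase x).Nonempty := by
    rw [← Finset.card_pos]
    obtain ⟨k, hk⟩ := hT
    omega
  obtain ⟨y, hy, hymin⟩ : ∃ y ∈ T.erase x, ∀ z ∈ T.erase x, y ≤ z :=
    ⟨_, (T.erase x).min'_mem hne', fun z hz => (T.erase x).min'_le z hz⟩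
  have hcard' := Finset.card_erase_add_one hy
  obtain ⟨hyx, hyT⟩ := Finset.mem_erase.mp hy
  have hsub : (T.erase x).erase y ⊆ T := (Finset.erase_subset _ _).trans (Finset.erase_subset _ _)
  obtain ⟨M, hM, hMv⟩ := ih _ (by omega) ((T.erase x).erase y)
    (by obtain ⟨k, hk⟩ := hT; exact ⟨k - 1, by omega⟩) (hφ.mono (by exact_mod_cast hsub))
    (fun u hu v hv huv hcons => hadj u (hsub hu) v (hsub hv) huv fun z hz huz => by
      refine hcons z ?_ huz
      have hxu := hxmin u (hsub hu)
      have hyu := hymin u (Finset.mem_of_mem_erase hu)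
      exact Finset.mem_erase.mpr ⟨(hyu.trans_lt huz).ne',
        Finset.mem_erase.mpr ⟨(hxu.trans_lt huz).ne', hz⟩⟩) rfl
  have hxy : G.Adj (φ x) (φ y) := hadj x hx y hyT (lt_of_le_of_ne (hxmin y hyT) hyx.symm)
    fun z hz hxz => hymin z (Finset.mem_erase.mpr ⟨hxz.ne', hz⟩)
  have himg : φ '' T = φ '' ((T.erase x).erase y : Finset α) ∪ {φ x, φ y} := by
    conv_lhs => rw [← Finset.insert_erase hx, ← Finset.insert_erase hy]
    simp only [Finset.coe_insert, Set.image_insert_eq]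
    ext; simp only [Set.mem_insert_iff, Set.mem_union, Set.mem_singleton_iff]; tauto
  refine ⟨M ⊔ G.subgraphOfAdj hxy, hM.sup (Subgraph.IsMatching.subgraphOfAdj hxy) ?_, ?_⟩
  · rw [hM.support_eq_verts, (Subgraph.IsMatching.subgraphOfAdj hxy).support_eq_verts, hMv,
      Set.disjoint_left]
    rintro _ ⟨z, hz, rfl⟩ hzmem
    obtain ⟨hzy, hz'⟩ := Finset.mem_erase.mp (Finset.mem_coe.mp hz)
    obtain ⟨hzx, hzT⟩ := Finset.mem_erase.mp hz'
    rcases hzmem with h | h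
    · exact hzx (hφ hzT hx h)
    · exact hzy (hφ hzT hyT h)
  · rw [himg, Subgraph.verts_sup, hMv, subgraphOfAdj_verts]

/-- Translating `{0, …, ν - 1}` by `a` parametrizes `ZMod ν` injectively. -/
theorem ZMod.injOn_add_natCast {ν : ℕ} (a : ZMod ν) :
    Set.InjOn (fun i : ℕ => a + (i : ZMod ν)) (Finset.range ν) := by
  intro i hi j hj hij
  have hcast : (i : ZMod ν) = j := add_left_cancel hij
  rw [ZMod.natCast_eq_natCast_iff] at hcast
  exact hcast.eq_of_lt_of_lt (by simpa using hi) (by simpa using hj)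

/-- A set of fewer than `2r` elements of `ZMod ν` can be cut open at some `a` such that no `r`
consecutive elements of it lie strictly after an element of the complement. -/
theorem ZMod.exists_cut {r ν : ℕ} (S : Finset (ZMod ν)) (hS : S.card < 2 * r) :
    ∃ a : ZMod ν, ∀ x : ℕ, x + r < ν → a + (x : ZMod ν) ∉ S →
      ∃ i ∈ Finset.Ioc x (x + r), a + (i : ZMod ν) ∉ S := by
  by_cases hrun : ∃ c : ZMod ν, ∀ i < r, c + (i : ZMod ν) ∈ S
  · obtain ⟨c, hc⟩ := hrun
    refine ⟨c, fun x hxν hx => ?_⟩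
    by_contra! hall
    have hrx : r ≤ x := not_lt.mp fun h => hx (hc x h)
    have hdisj : Disjoint (Finset.range r) (Finset.Ioc x (x + r)) := by
      rw [Finset.disjoint_left]
      intro i hi hi'
      simp only [Finset.mem_range, Finset.mem_Ioc] at hi hi'
      omega
    have hle : (Finset.range r ∪ Finset.Ioc x (x + r)).card ≤ S.card := by
      refine Finset.card_le_card_of_injOn (fun i : ℕ => c + (i : ZMod ν)) ?_
        ((ZMod.injOn_add_natCast c).mono ?_)
      · intro i hi
        rcases Finset.mem_union.mp hi with h | h
        · exact hc i (Finset.mem_range.mp h)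
        · exact hall i h
      · intro i hi
        simp only [Finset.coe_union, Finset.coe_range, Finset.coe_Ioc, Set.mem_union, Set.mem_Iio,
          Set.mem_Ioc] at hi ⊢
        omega
    rw [Finset.card_union_of_disjoint hdisj] at hle
    simp only [Finset.card_range, Nat.card_Ioc] at hle
    omega
  · push Not at hrun
    refine ⟨0, fun x _ _ => ?_⟩
    obtain ⟨i, hi, hiS⟩ := hrun ((x + 1 : ℕ) : ZMod ν)
    refine ⟨x + 1 + i, Finset.mem_Ioc.mpr ⟨by omega, by omega⟩, ?_⟩
    rwa [zero_add, Nat.cast_add]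

theorem hararyEven_isFactorCritical_of_even (r ν : ℕ) (hr : 2 ≤ r) (hν : 2 * r < ν)
    (heven : Even ν) : IsFactorCritical (hararyEven r ν) (2 * r - 2) := by
  intro S hS
  have : NeZero ν := ⟨by omega⟩
  obtain ⟨a, ha⟩ := ZMod.exists_cut (r := r) S (by omega)
  set φ : ℕ → ZMod ν := fun i => a + (i : ZMod ν) with hφ
  set T := (Finset.range ν).filter (fun i => φ i ∉ S) with hT
  have hinj : Set.InjOn φ T :=
    (ZMod.injOn_add_natCast a).mono (by exact_mod_cast Finset.filter_subset _ _)
  have himg : T.image φ = Sᶜ := by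
    ext v
    simp only [hT, Finset.mem_image, Finset.mem_filter, Finset.mem_range, Finset.mem_compl]
    constructor
    · rintro ⟨i, ⟨-, hi⟩, rfl⟩
      exact hi
    · intro hv
      have hval : φ (v - a).val = v := by simp [hφ]
      exact ⟨(v - a).val, ⟨ZMod.val_lt _, by rwa [hval]⟩, hval⟩
  have hcard : Even T.card := by
    rw [← Finset.card_image_of_injOn hinj, himg, Finset.card_compl, ZMod.card, hS]
    obtain ⟨k, hk⟩ := heven
    exact ⟨k - (r - 1), by omega⟩
  obtain ⟨M, hM, hMv⟩ := exists_isMatching_verts_eq_image (hararyEven r ν) φ T hcard hinj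
    (fun x hx y hy hxy hcons => by
      have hyν : y < ν := Finset.mem_range.mp (Finset.mem_filter.mp hy).1
      have hle : y ≤ x + r := by
        by_contra! hlt
        obtain ⟨i, hi, hiS⟩ := ha x (by omega) (Finset.mem_filter.mp hx).2
        obtain ⟨hxi, hir⟩ := Finset.mem_Ioc.mp hi
        have := hcons i (Finset.mem_filter.mpr ⟨Finset.mem_range.mpr (by omega), hiS⟩) hxi
        omega
      refine (SimpleGraph.fromRel_adj _ _ _).mpr
        ⟨fun h => hxy.ne (hinj hx hy h), Or.inl ⟨y - x, by omega, by omega, ?_⟩⟩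
      simp [hφ, Nat.cast_sub hxy.le])
  refine ⟨M, hM, ?_⟩
  rw [hMv, ← Finset.coe_image, himg, Finset.coe_compl]
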